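/- For every integer g ≥ 1, every τ ∈ ℍ_g and every z ∈ ℂ^g: Σ_{ε,δ ∈ {0,1}^g} θ_{[ε,δ]}(τ, z/2)⁸ = Σ_{ε,δ ∈ {0,1}^g} θ_{[ε,δ]}(τ)⁶·θ_{[ε,δ]}(τ, z)², where both sums run over all 2^{2g} characteristics (including the odd ones). -/

import Mathlib

open scoped BigOperators

noncomputable section

/-- The Siegel upper half-space: symmetric complex matrices with positive
definite imaginary part (indexed by a finite type `ι`). -/
def Siegel (ι : Type) [Fintype ι] : Set (Matrix ι ι ℂ) :=
  {τ | τ.IsSymm ∧ ∀ v : ι → ℝ, v ≠ 0 → 0 < ∑ i, ∑ j, v i * (τ i j).im * v j}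

/-- The theta function with characteristic `[ε, δ]`. -/
def theta {ι : Type} [Fintype ι] (ε δ : ι → ZMod 2) (τ : Matrix ι ι ℂ) (z : ι → ℂ) : ℂ :=
  ∑' n : ι → ℤ, Complex.exp ((Real.pi : ℂ) * Complex.I *
    ((∑ i, ∑ j, ((n i : ℂ) + ((ε i).val : ℂ) / 2) * τ i j * ((n j : ℂ) + ((ε j).val : ℂ) / 2)) +
     2 * ∑ i, ((n i : ℂ) + ((ε i).val : ℂ) / 2) * (z i + ((δ i).val : ℂ) / 2)))

/-- A theta characteristic, an element of `𝔽₂^{2g}`. -/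
abbrev Char2 (ι : Type) := (ι → ZMod 2) × (ι → ZMod 2)

/-- Theta function, with the characteristic as a pair. -/
def thetaChar {ι : Type} [Fintype ι] (m : Char2 ι) (τ : Matrix ι ι ℂ) (z : ι → ℂ) : ℂ :=
  theta m.1 m.2 τ z

/-- Theta constant. -/
def thetaConst {ι : Type} [Fintype ι] (m : Char2 ι) (τ : Matrix ι ι ℂ) : ℂ :=
  thetaChar m τ 0

/-- A finite product of absolutely convergent series, expanded over functions. -/
theorem summable_norm_prod_and_tsum_prod {α R : Type*} [NormedCommRing R] [NormOneClass R]
    [NormMulClass R] [CompleteSpace R] (n : ℕ) (f : Fin n → α → R)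
    (hf : ∀ k, Summable fun a => ‖f k a‖) :
    (Summable fun x : Fin n → α => ‖∏ k, f k (x k)‖) ∧
      ∑' x : Fin n → α, ∏ k, f k (x k) = ∏ k, ∑' a, f k a := by
  induction n with
  | zero => exact ⟨(hasSum_fintype _).summable, by simp⟩
  | succ n ih =>
    obtain ⟨hs, ht⟩ := ih (fun k => f k.succ) (fun k => hf k.succ)
    constructor
    · rw [← (Fin.consEquiv fun _ => α).summable_iff]
      simpa [Function.comp_def, Fin.prod_univ_succ, Fin.consEquiv, norm_mul] using
        (hf 0).mul_norm hs
    · rw [← (Fin.consEquiv fun _ => α).tsum_eq]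
      simp only [Fin.consEquiv, Equiv.coe_fn_mk, Fin.prod_univ_succ, Fin.cons_zero, Fin.cons_succ]
      rw [← ht, tsum_mul_tsum_of_summable_norm (hf 0) hs]

/-- A positive definite real quadratic form dominates a multiple of the sum of squares. -/
theorem exists_pos_mul_sum_sq_le {ι : Type*} [Fintype ι] (A : ι → ι → ℝ)
    (hA : ∀ v : ι → ℝ, v ≠ 0 → 0 < ∑ i, ∑ j, v i * A i j * v j) :
    ∃ c : ℝ, 0 < c ∧ ∀ v : ι → ℝ, c * ∑ i, v i ^ 2 ≤ ∑ i, ∑ j, v i * A i j * v j := by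
  have hne : ∀ v ∈ Metric.sphere (0 : EuclideanSpace ℝ ι) 1,
      0 < ∑ i, ∑ j, v i * A i j * v j := by
    intro v hv
    refine hA v fun h => ?_
    have : v = 0 := by ext i; simpa using congrFun h i
    simp [this] at hv
  obtain ⟨c, hc, hcle⟩ := (isCompact_sphere (0 : EuclideanSpace ℝ ι) 1).exists_forall_le'
    (by fun_prop) hne
  refine ⟨c, hc, fun v => ?_⟩
  set w : EuclideanSpace ℝ ι := WithLp.toLp 2 v
  have hw : ‖w‖ ^ 2 = ∑ i, v i ^ 2 := by simp [w, EuclideanSpace.real_norm_sq_eq]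
  rcases eq_or_ne w 0 with h0 | h0
  · have hv : v = 0 := by
      ext i
      simpa [w] using congrArg (fun u : EuclideanSpace ℝ ι => u i) h0
    simp [hv]
  have hn : ‖w‖ ≠ 0 := norm_ne_zero_iff.mpr h0
  have h1 := hcle (‖w‖⁻¹ • w) (by simp [norm_smul, hn])
  have h2 : ∑ i, ∑ j, (‖w‖⁻¹ • w) i * A i j * (‖w‖⁻¹ • w) j =
      (‖w‖ ^ 2)⁻¹ * ∑ i, ∑ j, v i * A i j * v j := by
    simp only [Finset.mul_sum]
    refine Finset.sum_congr rfl fun i _ => Finset.sum_congr rfl fun j _ => ?_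
    simp only [PiLp.smul_apply, smul_eq_mul, w]
    field_simp
  rw [h2, ← div_eq_inv_mul, le_div_iff₀ (by positivity), hw] at h1
  exact h1

/-- The general term of the theta series with characteristic `[ε, δ]`. -/
def thetaTerm {ι : Type} [Fintype ι] (ε δ : ι → ZMod 2) (τ : Matrix ι ι ℂ) (z : ι → ℂ)
    (n : ι → ℤ) : ℂ :=
  Complex.exp ((Real.pi : ℂ) * Complex.I *
    ((∑ i, ∑ j, ((n i : ℂ) + ((ε i).val : ℂ) / 2) * τ i j * ((n j : ℂ) + ((ε j).val : ℂ) / 2)) +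
     2 * ∑ i, ((n i : ℂ) + ((ε i).val : ℂ) / 2) * (z i + ((δ i).val : ℂ) / 2)))

theorem summable_exp_neg_sq_shift {c : ℝ} (hc : 0 < c) (a b : ℝ) :
    Summable fun n : ℤ => Real.exp (-Real.pi * (c * (n + a) ^ 2 + 2 * ((n + a) * b))) := by
  have h := ((summable_jacobiTheta₂_term_iff ((c * a + b : ℝ) * Complex.I)
    ((c : ℂ) * Complex.I)).mpr (by simpa using hc)).norm.mul_left
      (Real.exp (-Real.pi * (c * a ^ 2 + 2 * (a * b))))
  refine h.congr fun n => ?_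
  rw [norm_jacobiTheta₂_term, ← Real.exp_add]
  congr 1
  simp only [Complex.im_ofReal_mul, Complex.I_im]
  ring

theorem norm_thetaTerm {ι : Type} [Fintype ι] (ε δ : ι → ZMod 2) (τ : Matrix ι ι ℂ)
    (z : ι → ℂ) (n : ι → ℤ) :
    ‖thetaTerm ε δ τ z n‖ = Real.exp (-Real.pi *
      ((∑ i, ∑ j, ((n i : ℝ) + ((ε i).val : ℝ) / 2) * (τ i j).im *
          ((n j : ℝ) + ((ε j).val : ℝ) / 2)) + 2 * ∑ i, ((n i : ℝ) + ((ε i).val : ℝ) / 2) * (z i).im)) := by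
  have hreal : ∀ i, (n i : ℂ) + ((ε i).val : ℂ) / 2 =
      (((n i : ℝ) + ((ε i).val : ℝ) / 2 : ℝ) : ℂ) := fun i => by push_cast; ring
  have hδ : ∀ i, ((δ i).val : ℂ) / 2 = ((((δ i).val : ℝ) / 2 : ℝ) : ℂ) := fun i => by
    push_cast; ring
  rw [thetaTerm, Complex.norm_exp]
  congr 1
  have h2 : (2 : ℂ) = ((2 : ℝ) : ℂ) := by norm_num
  simp only [hreal, hδ]
  rw [mul_assoc, Complex.re_ofReal_mul, Complex.I_mul_re, Complex.add_im, h2,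
    Complex.im_ofReal_mul, Complex.im_sum, Complex.im_sum]
  simp only [Complex.im_sum, Complex.im_mul_ofReal, Complex.im_ofReal_mul, Complex.add_im,
    Complex.ofReal_im, add_zero]
  ring

theorem summable_norm_thetaTerm {g : ℕ} {τ : Matrix (Fin g) (Fin g) ℂ} (hτ : τ ∈ Siegel (Fin g))
    (ε δ : Fin g → ZMod 2) (z : Fin g → ℂ) :
    Summable fun n => ‖thetaTerm ε δ τ z n‖ := by
  obtain ⟨c, hc, hle⟩ := exists_pos_mul_sum_sq_le (fun i j => (τ i j).im) hτ.2
  have hs := (summable_norm_prod_and_tsum_prod g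
    (fun i (m : ℤ) => Real.exp (-Real.pi * (c * (m + ((ε i).val : ℝ) / 2) ^ 2 +
      2 * ((m + ((ε i).val : ℝ) / 2) * (z i).im))))
    fun i => (summable_exp_neg_sq_shift hc _ _).norm).1
  refine hs.of_nonneg_of_le (fun _ => norm_nonneg _) fun n => ?_
  rw [norm_thetaTerm, ← Real.exp_sum, Real.norm_of_nonneg (Real.exp_pos _).le, Real.exp_le_exp,
    ← Finset.mul_sum, Finset.sum_add_distrib, ← Finset.mul_sum, ← Finset.mul_sum]
  have := hle fun i => (n i : ℝ) + ((ε i).val : ℝ) / 2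
  nlinarith [Real.pi_pos]

theorem prod_theta_eq_tsum {g : ℕ} {τ : Matrix (Fin g) (Fin g) ℂ} (hτ : τ ∈ Siegel (Fin g))
    (ε δ : Fin g → ZMod 2) {m : ℕ} (x : Fin m → Fin g → ℂ) :
    (Summable fun N : Fin m → Fin g → ℤ => ∏ k, thetaTerm ε δ τ (x k) (N k)) ∧
      ∏ k, theta ε δ τ (x k) = ∑' N : Fin m → Fin g → ℤ, ∏ k, thetaTerm ε δ τ (x k) (N k) := by
  obtain ⟨hs, ht⟩ := summable_norm_prod_and_tsum_prod m (fun k => thetaTerm ε δ τ (x k))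
    fun k => summable_norm_thetaTerm hτ ε δ (x k)
  exact ⟨hs.of_norm, ht.symm⟩

/-- The term of the theta series of the `E₈` lattice, written in doubled coordinates. -/
def latticeTerm {g : ℕ} (τ : Matrix (Fin g) (Fin g) ℂ) (x : Fin 8 → Fin g → ℂ)
    (M : Fin 8 → Fin g → ℤ) : ℂ :=
  Complex.exp ((Real.pi : ℂ) * Complex.I *
    ((∑ i, ∑ j, (∑ k, (M k i : ℂ) * M k j) * τ i j) / 4 + ∑ i, ∑ k, (M k i : ℂ) * x k i))

/-- The lattice `E₈ ⊗ ℤ^g` in doubled coordinates. -/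
def doubledE8 (g : ℕ) : Set (Fin 8 → Fin g → ℤ) :=
  {M | (∀ k i, (M k i : ZMod 2) = M 0 i) ∧ ∀ i, 4 ∣ ∑ k, M k i}

/-- The doubled coordinates of the vector `N + ε / 2`. -/
def doubledShift {g : ℕ} (ε : Fin g → ZMod 2) (N : Fin 8 → Fin g → ℤ) : Fin 8 → Fin g → ℤ :=
  fun k i => 2 * N k i + (ε i).val

theorem doubledShift_injective {g : ℕ} (ε : Fin g → ZMod 2) :
    Function.Injective (doubledShift ε) := by
  intro N N' h
  ext k i
  have := congrFun (congrFun h k) i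
  simp only [doubledShift] at this
  omega

theorem doubledShift_cast {g : ℕ} (ε : Fin g → ZMod 2) (N : Fin 8 → Fin g → ℤ) (k : Fin 8)
    (i : Fin g) : (doubledShift ε N k i : ZMod 2) = ε i := by
  have h2 : (2 : ZMod 2) = 0 := rfl
  simp [doubledShift, h2]

theorem doubledShift_mem_iff {g : ℕ} (ε : Fin g → ZMod 2) (N : Fin 8 → Fin g → ℤ) :
    doubledShift ε N ∈ doubledE8 g ↔ ∀ i, Even (∑ k, N k i) := by
  have h : ∀ i, (4 ∣ ∑ k, doubledShift ε N k i) ↔ Even (∑ k, N k i) := fun i => by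
    simp only [doubledShift, Fin.sum_univ_eight, Int.even_iff]
    omega
  simp only [doubledE8, Set.mem_ofPred_eq, doubledShift_cast, h, implies_true, true_and]

theorem prod_thetaTerm {g : ℕ} (ε δ : Fin g → ZMod 2) (τ : Matrix (Fin g) (Fin g) ℂ)
    (x : Fin 8 → Fin g → ℂ) (N : Fin 8 → Fin g → ℤ) :
    ∏ k, thetaTerm ε δ τ (x k) (N k) = latticeTerm τ x (doubledShift ε N) *
      ∏ i, ((-1 : ℂ) ^ (∑ k, N k i)) ^ (δ i).val := by
  have hsign : ∀ i, ((-1 : ℂ) ^ (∑ k, N k i)) ^ (δ i).val =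
      Complex.exp (Real.pi * Complex.I * ((δ i).val * ((∑ k, (N k i : ℂ)) + 4 * (ε i).val))) := by
    intro i
    have hper : Complex.exp (Real.pi * Complex.I * (4 * (ε i).val)) = 1 := by
      rw [Complex.exp_eq_one_iff]
      exact ⟨2 * (ε i).val, by push_cast; ring⟩
    have hexp : (-1 : ℂ) ^ (∑ k, N k i) = Complex.exp (Real.pi * Complex.I *
        ((∑ k, (N k i : ℂ)) + 4 * (ε i).val)) := by
      rw [mul_add, Complex.exp_add, hper, mul_one, ← Complex.exp_pi_mul_I, ← Complex.exp_int_mul]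
      push_cast
      ring_nf
    rw [hexp, ← Complex.exp_nat_mul]
    ring_nf
  simp only [hsign, thetaTerm, latticeTerm]
  rw [← Complex.exp_sum, ← Complex.exp_sum, ← Complex.exp_add, ← Finset.mul_sum, ← Finset.mul_sum,
    ← mul_add, Finset.sum_add_distrib, ← Finset.mul_sum]
  congr 2
  have hquad : ∑ k, ∑ i, ∑ j, ((N k i : ℂ) + ((ε i).val : ℂ) / 2) * τ i j *
      ((N k j : ℂ) + ((ε j).val : ℂ) / 2) = (∑ i, ∑ j,
        (∑ k, (doubledShift ε N k i : ℂ) * doubledShift ε N k j) * τ i j) / 4 := by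
    rw [Finset.sum_comm, Finset.sum_div]
    refine Finset.sum_congr rfl fun i _ => ?_
    rw [Finset.sum_comm, Finset.sum_div]
    refine Finset.sum_congr rfl fun j _ => ?_
    rw [Finset.sum_mul, Finset.sum_div]
    refine Finset.sum_congr rfl fun k _ => ?_
    simp only [doubledShift]
    push_cast
    ring
  have hlin : 2 * ∑ k, ∑ i, ((N k i : ℂ) + ((ε i).val : ℂ) / 2) * (x k i + ((δ i).val : ℂ) / 2) =
      ∑ i, ∑ k, (doubledShift ε N k i : ℂ) * x k i +
        ∑ i, ((δ i).val : ℂ) * ((∑ k, (N k i : ℂ)) + 4 * (ε i).val) := by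
    rw [Finset.sum_comm, Finset.mul_sum, ← Finset.sum_add_distrib]
    refine Finset.sum_congr rfl fun i _ => ?_
    simp only [doubledShift, Fin.sum_univ_eight]
    push_cast
    ring
  rw [hquad, hlin, add_assoc]

theorem sum_prod_sign {g : ℕ} (S : Fin g → ℤ) [Decidable (∀ i, Even (S i))] :
    ∑ δ : Fin g → ZMod 2, ∏ i, ((-1 : ℂ) ^ S i) ^ (δ i).val =
      if ∀ i, Even (S i) then 2 ^ g else 0 := by
  have hsum : ∀ i, ∑ d : ZMod 2, ((-1 : ℂ) ^ S i) ^ d.val = 1 + (-1) ^ S i := fun i => by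
    simp [show (Finset.univ : Finset (ZMod 2)) = {0, 1} from rfl, ZMod.val_one]
  rw [← Fintype.prod_sum fun i (d : ZMod 2) => ((-1 : ℂ) ^ S i) ^ d.val]
  simp only [hsum]
  split_ifs with h
  · rw [Finset.prod_congr rfl fun i _ => by rw [(h i).neg_one_zpow]]
    norm_num
  · push Not at h
    obtain ⟨i, hi⟩ := h
    refine Finset.prod_eq_zero (Finset.mem_univ i) ?_
    rw [(Int.not_even_iff_odd.mp hi).neg_one_zpow]
    norm_num

theorem sum_prod_thetaTerm {g : ℕ} (ε : Fin g → ZMod 2) (τ : Matrix (Fin g) (Fin g) ℂ)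
    (x : Fin 8 → Fin g → ℂ) (N : Fin 8 → Fin g → ℤ) :
    ∑ δ, ∏ k, thetaTerm ε δ τ (x k) (N k) =
      2 ^ g * (doubledE8 g).indicator (latticeTerm τ x) (doubledShift ε N) := by
  classical
  simp only [prod_thetaTerm]
  rw [← Finset.mul_sum, sum_prod_sign, Set.indicator_apply]
  simp only [doubledShift_mem_iff]
  split_ifs <;> ring

/-- A sum over vectors with all rows congruent modulo two, split by the common residue. -/
theorem sum_tsum_doubledShift {g : ℕ} (F : (Fin 8 → Fin g → ℤ) → ℂ)
    (hF : ∀ M, F M ≠ 0 → ∀ k i, (M k i : ZMod 2) = M 0 i)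
    (hs : ∀ ε, Summable fun N => F (doubledShift ε N)) :
    ∑ ε, ∑' N, F (doubledShift ε N) = ∑' M, F M := by
  classical
  let R (ε : Fin g → ZMod 2) : (Fin 8 → Fin g → ℤ) → ℂ := (Set.range (doubledShift ε)).indicator F
  have hcomp : ∀ ε, R ε ∘ doubledShift ε = fun N => F (doubledShift ε N) := fun ε => by
    ext N
    simp [R]
  have hsum : ∀ ε, Summable (R ε) := fun ε => by
    rw [← (doubledShift_injective ε).summable_iff fun M hM => Set.indicator_of_notMem hM F, hcomp]
    exact hs ε
  have htsum : ∀ ε, ∑' N, F (doubledShift ε N) = ∑' M, R ε M := fun ε => by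
    rw [← (doubledShift_injective ε).tsum_eq Set.support_indicator_subset]
    exact congrArg tsum (hcomp ε).symm
  simp only [htsum]
  rw [← Summable.tsum_finsetSum fun ε _ => hsum ε]
  refine tsum_congr fun M => ?_
  by_cases hM : F M = 0
  · simp [R, Set.indicator_apply, hM]
  rw [Finset.sum_eq_single fun i => (M 0 i : ZMod 2)]
  · have hmem : M ∈ Set.range (doubledShift fun i => (M 0 i : ZMod 2)) := by
      refine ⟨fun k i => M k i / 2, ?_⟩
      ext k i
      have h := hF M hM k i
      rw [ZMod.intCast_eq_intCast_iff_dvd_sub] at h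
      simp only [doubledShift, ZMod.val_intCast]
      push_cast at h ⊢
      omega
    exact Set.indicator_of_mem hmem F
  · rintro ε - hε
    refine Set.indicator_of_notMem ?_ F
    rintro ⟨N, rfl⟩
    exact hε (funext fun i => (doubledShift_cast ε N 0 i).symm)
  · simp

/-- The sum over all characteristics of a product of eight theta functions is a theta series of
the `E₈` lattice. -/
theorem sum_prod_theta_eq_tsum {g : ℕ} {τ : Matrix (Fin g) (Fin g) ℂ} (hτ : τ ∈ Siegel (Fin g))
    (x : Fin 8 → Fin g → ℂ) :
    ∑ ε : Fin g → ZMod 2, ∑ δ : Fin g → ZMod 2, ∏ k, theta ε δ τ (x k) =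
      2 ^ g * ∑' M, (doubledE8 g).indicator (latticeTerm τ x) M := by
  have hsum : ∀ ε : Fin g → ZMod 2, Summable fun N =>
      2 ^ g * (doubledE8 g).indicator (latticeTerm τ x) (doubledShift ε N) := fun ε => by
    simp only [← sum_prod_thetaTerm]
    exact summable_sum fun δ _ => (prod_theta_eq_tsum hτ ε δ x).1
  rw [← tsum_mul_left, ← sum_tsum_doubledShift _ _ hsum]
  · refine Finset.sum_congr rfl fun ε _ => ?_
    simp only [(prod_theta_eq_tsum hτ _ _ x).2, ← sum_prod_thetaTerm]
    exact (Summable.tsum_finsetSum fun δ _ => (prod_theta_eq_tsum hτ ε δ x).1).symm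
  · intro M hM
    exact (Set.mem_of_indicator_ne_zero (right_ne_zero_of_mul hM)).1

/-- Twice the root `(1/2, 1/2, 1/2, 1/2, 1/2, 1/2, -1/2, -1/2)` of `E₈`. -/
def doubledRoot : Fin 8 → ℤ := ![1, 1, 1, 1, 1, 1, -1, -1]

/-- The inner product of a vector of `E₈` in doubled coordinates with the root. -/
def rootCoeff {g : ℕ} (M : Fin 8 → Fin g → ℤ) (i : Fin g) : ℤ :=
  (∑ k, doubledRoot k * M k i) / 4

/-- The reflection of `E₈` in the root, in doubled coordinates. -/
def rootReflection {g : ℕ} (M : Fin 8 → Fin g → ℤ) : Fin 8 → Fin g → ℤ :=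
  fun k i => M k i - doubledRoot k * rootCoeff M i

theorem sum_doubledRoot_mul {g : ℕ} (M : Fin 8 → Fin g → ℤ) (i : Fin g) :
    ∑ k, doubledRoot k * M k i =
      M 0 i + M 1 i + M 2 i + M 3 i + M 4 i + M 5 i - M 6 i - M 7 i := by
  simp [doubledRoot, Fin.sum_univ_eight]
  ring

theorem four_mul_rootCoeff {g : ℕ} {M : Fin 8 → Fin g → ℤ} (hM : M ∈ doubledE8 g) (i : Fin g) :
    4 * rootCoeff M i = M 0 i + M 1 i + M 2 i + M 3 i + M 4 i + M 5 i - M 6 i - M 7 i := by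
  have h6 := hM.1 6 i
  have h7 := hM.1 7 i
  have h4 := hM.2 i
  rw [ZMod.intCast_eq_intCast_iff_dvd_sub] at h6 h7
  rw [Fin.sum_univ_eight] at h4
  rw [rootCoeff, sum_doubledRoot_mul]
  push_cast at h6 h7
  omega

theorem rootReflection_mem {g : ℕ} {M : Fin 8 → Fin g → ℤ} (hM : M ∈ doubledE8 g) :
    rootReflection M ∈ doubledE8 g := by
  have hroot : ∀ k, (doubledRoot k : ZMod 2) = 1 := by decide
  refine ⟨fun k i => ?_, fun i => ?_⟩
  · simp only [rootReflection]
    push_cast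
    rw [hM.1 k i, hroot k, hroot 0]
  · have h4 := hM.2 i
    simp [rootReflection, doubledRoot, Fin.sum_univ_eight] at h4 ⊢
    omega

theorem rootReflection_involutive {g : ℕ} {M : Fin 8 → Fin g → ℤ} (hM : M ∈ doubledE8 g) :
    rootReflection (rootReflection M) = M := by
  have hc : ∀ i, rootCoeff (rootReflection M) i = -rootCoeff M i := fun i => by
    have h := four_mul_rootCoeff hM i
    have h' := four_mul_rootCoeff (rootReflection_mem hM) i
    simp [rootReflection, doubledRoot] at h'
    change 4 * rootCoeff (rootReflection M) i = _ at h'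
    omega
  ext k i
  rw [rootReflection, hc, rootReflection]
  ring

/-- The reflection in the root as a permutation of the lattice. -/
def rootReflectionEquiv (g : ℕ) : doubledE8 g ≃ doubledE8 g :=
  Function.Involutive.toPerm (fun M => ⟨rootReflection M.1, rootReflection_mem M.2⟩)
    fun M => Subtype.ext (rootReflection_involutive M.2)

theorem latticeTerm_rootReflection {g : ℕ} (τ : Matrix (Fin g) (Fin g) ℂ) (z : Fin g → ℂ)
    {M : Fin 8 → Fin g → ℤ} (hM : M ∈ doubledE8 g) :
    latticeTerm τ ![0, 0, 0, 0, 0, 0, z, z] (rootReflection M) =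
      latticeTerm τ (fun _ i => z i / 2) M := by
  have hc : ∀ i, (4 * rootCoeff M i : ℂ) =
      M 0 i + M 1 i + M 2 i + M 3 i + M 4 i + M 5 i - M 6 i - M 7 i := fun i => by
    exact_mod_cast four_mul_rootCoeff hM i
  have hquad : ∀ i j, ∑ k, (rootReflection M k i : ℂ) * rootReflection M k j =
      ∑ k, (M k i : ℂ) * M k j := fun i j => by
    simp [rootReflection, doubledRoot, Fin.sum_univ_eight]
    linear_combination (rootCoeff M j : ℂ) * hc i + (rootCoeff M i : ℂ) * hc j
  have hlin : ∀ i, ∑ k, (rootReflection M k i : ℂ) *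
      (![0, 0, 0, 0, 0, 0, z, z] : Fin 8 → Fin g → ℂ) k i = ∑ k, (M k i : ℂ) * (z i / 2) :=
    fun i => by
      simp [rootReflection, doubledRoot, Fin.sum_univ_eight]
      linear_combination z i / 2 * hc i
  simp only [latticeTerm, hquad, hlin]

/-- Summing eighth powers of theta functions at `z/2` over all characteristics. -/
theorem sum_theta_eighth_power_half (g : ℕ) (hg : 1 ≤ g)
    (τ : Matrix (Fin g) (Fin g) ℂ) (hτ : τ ∈ Siegel (Fin g)) (z : Fin g → ℂ) :
    ∑ ε : Fin g → ZMod 2, ∑ δ : Fin g → ZMod 2, theta ε δ τ (fun i => z i / 2) ^ 8 =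
    ∑ ε : Fin g → ZMod 2, ∑ δ : Fin g → ZMod 2,
      theta ε δ τ 0 ^ 6 * theta ε δ τ z ^ 2 := by
  have hL := sum_prod_theta_eq_tsum hτ fun _ i => z i / 2
  have hR := sum_prod_theta_eq_tsum hτ ![0, 0, 0, 0, 0, 0, z, z]
  have hprod : ∀ ε δ : Fin g → ZMod 2,
      ∏ k, theta ε δ τ ((![0, 0, 0, 0, 0, 0, z, z] : Fin 8 → Fin g → ℂ) k) =
        theta ε δ τ 0 ^ 6 * theta ε δ τ z ^ 2 := fun ε δ => by
    simp [Fin.prod_univ_eight]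
    ring
  simp only [hprod] at hR
  simp only [Finset.prod_const, Finset.card_univ, Fintype.card_fin] at hL
  rw [hL, hR, ← tsum_subtype, ← tsum_subtype, ← (rootReflectionEquiv g).tsum_eq fun M =>
    latticeTerm τ ![0, 0, 0, 0, 0, 0, z, z] M]
  exact congrArg _ (tsum_congr fun M => (latticeTerm_rootReflection τ z M.2).symm)
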